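/- arXiv:2405.01907 — 5 statements merged into one kernel-verified Lean document; each statement's English description precedes it below -/
import Mathlib

section
/- Let Λ = ℤ² ∪ {(√2·m₁, m₂ + 1/2) : m₁, m₂ ∈ ℤ} ⊆ ℝ². Then for every invertible 2×2 real matrix M, the set Λ + M(Λ) = {x + M·y : x, y ∈ Λ} has an accumulation point in ℝ² (i.e., it is not a discrete set). -/
open Matrix

/-- If `a` is irrational, distinct integer multiples of `a` have distinct fractional parts. -/
theorem Irrational.injective_fract_intCast_mul {a : ℝ} (ha : Irrational a) :
    Function.Injective fun k : ℤ => Int.fract (k * a) := by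
  intro k l hkl
  by_contra hne
  obtain ⟨z, hz⟩ := Int.fract_eq_fract.mp hkl
  have h : Irrational (((k - l : ℤ) : ℝ) * a) := ha.intCast_mul (sub_ne_zero.mpr hne)
  refine h.ne_int z ?_
  push_cast
  linarith

/-- A subset of the plane which contains a translate of `ℤ² + ℤ (a, b)` with `a` or `b` irrational
has an accumulation point. -/
theorem exists_accPt_of_irrational_translates {S : Set (EuclideanSpace ℝ (Fin 2))} {a b : ℝ}
    (c d : ℝ) (h : Irrational a ∨ Irrational b)
    (hS : ∀ k m n : ℤ, !₂[k * a + m + c, k * b + n + d] ∈ S) :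
    ∃ p, AccPt p (Filter.principal S) := by
  let g : ℝ × ℝ → EuclideanSpace ℝ (Fin 2) := fun x => !₂[x.1 + c, x.2 + d]
  have hg : Continuous g := by fun_prop
  let f : ℤ → EuclideanSpace ℝ (Fin 2) := fun k => g (Int.fract (k * a), Int.fract (k * b))
  have hf : Function.Injective f := by
    intro k l hkl
    have h0 := congrArg (fun v : EuclideanSpace ℝ (Fin 2) => v 0) hkl
    have h1 := congrArg (fun v : EuclideanSpace ℝ (Fin 2) => v 1) hkl
    simp only [f, g, cons_val_zero, cons_val_one, add_left_inj] at h0 h1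
    exact h.elim (fun ha => ha.injective_fract_intCast_mul h0)
      (fun hb => hb.injective_fract_intCast_mul h1)
  have hK : IsCompact (g '' Set.Icc 0 1 ×ˢ Set.Icc 0 1) :=
    (isCompact_Icc.prod isCompact_Icc).image hg
  have hfK : Set.range f ⊆ g '' Set.Icc 0 1 ×ˢ Set.Icc 0 1 := by
    rintro _ ⟨k, rfl⟩
    exact ⟨_, ⟨⟨Int.fract_nonneg _, (Int.fract_lt_one _).le⟩,
      ⟨Int.fract_nonneg _, (Int.fract_lt_one _).le⟩⟩, rfl⟩
  obtain ⟨p, -, hp⟩ := (Set.infinite_range_of_injective hf).exists_accPt_of_subset_isCompact hK hfK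
  refine ⟨p, hp.mono (Filter.principal_mono.mpr ?_)⟩
  rintro _ ⟨k, rfl⟩
  have := hS k (-⌊k * a⌋) (-⌊k * b⌋)
  simpa [f, g, Int.fract, sub_eq_add_neg] using this


/-- For `Λ = ℤ² ∪ {(√2·m₁, m₂ + 1/2) : m₁, m₂ ∈ ℤ}` and any invertible
`2×2` real matrix `M`, the set `Λ + M(Λ)` has an accumulation point in `ℝ²`. -/
theorem favorov_set_sum_not_discrete
    (M : Matrix (Fin 2) (Fin 2) ℝ) (hM : IsUnit M) :
    ∃ p : EuclideanSpace ℝ (Fin 2),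
      AccPt p (Filter.principal
        {z : EuclideanSpace ℝ (Fin 2) |
          ∃ x ∈ ({v : EuclideanSpace ℝ (Fin 2) |
              (∃ m n : ℤ, v = ![(m : ℝ), (n : ℝ)]) ∨
              (∃ m₁ m₂ : ℤ, v = ![Real.sqrt 2 * m₁, (m₂ : ℝ) + 1 / 2])}),
          ∃ y ∈ ({v : EuclideanSpace ℝ (Fin 2) |
              (∃ m n : ℤ, v = ![(m : ℝ), (n : ℝ)]) ∨
              (∃ m₁ m₂ : ℤ, v = ![Real.sqrt 2 * m₁, (m₂ : ℝ) + 1 / 2])}),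
            z = fun i => x i + M.mulVec y i}) := by
  by_cases h : Irrational (M 0 0) ∨ Irrational (M 1 0)
  · refine exists_accPt_of_irrational_translates 0 0 h fun k m n => ?_
    refine ⟨!₂[(m : ℝ), n], Or.inl ⟨m, n, rfl⟩, !₂[(k : ℝ), 0],
      Or.inl ⟨k, 0, by simp⟩, ?_⟩
    ext i
    fin_cases i <;> simp [mulVec, dotProduct, Fin.sum_univ_two] <;> ring
  · have h' : Irrational (M 0 0 * √2) ∨ Irrational (M 1 0 * √2) := by
      simp only [not_or, Irrational, not_not, Set.mem_range] at h
      obtain ⟨⟨p, hp⟩, q, hq⟩ := h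
      rw [← hp, ← hq]
      by_cases hp0 : p = 0
      · refine Or.inr (irrational_sqrt_two.ratCast_mul ?_)
        rintro rfl
        have hdet := (M.isUnit_iff_isUnit_det.mp hM).ne_zero
        simp [det_fin_two, ← hp, ← hq, hp0] at hdet
      · exact Or.inl (irrational_sqrt_two.ratCast_mul hp0)
    refine exists_accPt_of_irrational_translates (M 0 1 / 2) (M 1 1 / 2) h' fun k m n => ?_
    refine ⟨!₂[(m : ℝ), n], Or.inl ⟨m, n, rfl⟩, !₂[√2 * k, 1 / 2],
      Or.inr ⟨k, 0, by simp⟩, ?_⟩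
    ext i
    fin_cases i <;> simp [mulVec, dotProduct, Fin.sum_univ_two] <;> ring
end

section
/- Let a, c ∈ ℝ. If the set {(m + a·m′, n + c·m′) : m, n, m′ ∈ ℤ} ⊆ ℝ² has no accumulation point in ℝ², then a and c are both rational numbers. -/
/-- The fractional parts of the integer multiples of an irrational number are distinct. -/
theorem injective_fract_mul_of_irrational {x : ℝ} (hx : Irrational x) :
    Function.Injective fun k : ℤ => Int.fract (x * k) := by
  intro k l hkl
  by_contra hne
  obtain ⟨z, hz⟩ := Int.fract_eq_fract.1 hkl
  have hkl0 : k - l ≠ 0 := sub_ne_zero.2 hne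
  refine (hx.mul_intCast hkl0).ne_int z ?_
  rw [← hz]
  push_cast
  ring

/-- If `{(m + a·m′, n + c·m′) : m, n, m′ ∈ ℤ}` has no accumulation point
in `ℝ²`, then `a` and `c` are rational. -/
theorem rational_of_lattice_translates_discrete
    (a c : ℝ)
    (h : ∀ p : EuclideanSpace ℝ (Fin 2),
      ¬ AccPt p (Filter.principal
        {z : EuclideanSpace ℝ (Fin 2) |
          ∃ m n m' : ℤ, z = ![(m : ℝ) + a * m', (n : ℝ) + c * m']})) :
    (∃ q : ℚ, a = (q : ℝ)) ∧ (∃ q : ℚ, c = (q : ℝ)) := by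
  have key : ∀ f : ℤ → EuclideanSpace ℝ (Fin 2),
      (∀ k, f k = !₂[Int.fract (a * k), Int.fract (c * k)]) → ¬ Function.Injective f := by
    intro f hf hinj
    have hbdd : Set.range f ⊆ Metric.closedBall 0 2 := by
      rintro _ ⟨k, rfl⟩
      have h₁ := Int.fract_nonneg (a * k)
      have h₂ := (Int.fract_lt_one (a * k)).le
      have h₃ := Int.fract_nonneg (c * k)
      have h₄ := (Int.fract_lt_one (c * k)).le
      rw [mem_closedBall_zero_iff, hf, EuclideanSpace.norm_eq, Real.sqrt_le_left (by norm_num)]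
      simp only [Fin.sum_univ_two, Real.norm_eq_abs, sq_abs,
        Matrix.cons_val_zero, Matrix.cons_val_one]
      nlinarith
    obtain ⟨p, -, hp⟩ := (Set.infinite_range_of_injective hinj).exists_accPt_of_subset_isCompact
      (isCompact_closedBall 0 2) hbdd
    refine h p (hp.mono (Filter.principal_mono.2 ?_))
    rintro _ ⟨k, rfl⟩
    refine ⟨-⌊a * k⌋, -⌊c * k⌋, k, ?_⟩
    rw [hf]
    ext i
    fin_cases i <;> simp [neg_add_eq_sub]
  constructor
  · by_contra hq
    refine key _ (fun _ => rfl) fun k l hkl => ?_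
    have := congrArg (fun z : EuclideanSpace ℝ (Fin 2) => z 0) hkl
    exact injective_fract_mul_of_irrational (fun ⟨q, h⟩ => hq ⟨q, h.symm⟩) (by simpa using this)
  · by_contra hq
    refine key _ (fun _ => rfl) fun k l hkl => ?_
    have := congrArg (fun z : EuclideanSpace ℝ (Fin 2) => z 1) hkl
    exact injective_fract_mul_of_irrational (fun ⟨q, h⟩ => hq ⟨q, h.symm⟩) (by simpa using this)
end

section
/- Let d ≥ 1 and define Φ : ℝᵈ → ℝ by Φ(x) = (1 + |x|)^{-(d+1)}. Then for every s ∈ ℝᵈ, ∫_{ℝᵈ} Φ(u)·Φ(s − u) du ≤ 2·‖Φ‖_{L¹(ℝᵈ)} · (2/(2 + |s|))^{d+1}. -/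
open MeasureTheory

lemma integrable_inv_one_add_norm_pow (d : ℕ) :
    Integrable fun x : EuclideanSpace ℝ (Fin d) ↦ ((1 + ‖x‖) ^ (d + 1))⁻¹ := by
  have h := integrable_one_add_norm (E := EuclideanSpace ℝ (Fin d)) (μ := volume)
    (r := ((d + 1 : ℕ) : ℝ)) (by simp)
  refine h.congr (Filter.Eventually.of_forall fun x ↦ ?_)
  have hx : 0 ≤ 1 + ‖x‖ := by positivity
  simp only [Real.rpow_neg hx, Real.rpow_natCast]

lemma inv_pow_mul_inv_pow_le {a b t : ℝ} (ha : 0 < a) (hb : 0 < b) (ht : 0 < t)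
    (hab : t ≤ a + b) (n : ℕ) :
    (a ^ n)⁻¹ * (b ^ n)⁻¹ ≤ ((a ^ n)⁻¹ + (b ^ n)⁻¹) * (2 / t) ^ n := by
  wlog h : a ≤ b generalizing a b
  · simpa only [mul_comm, add_comm] using this hb ha (by linarith) (le_of_not_ge h)
  have hinv : (b ^ n)⁻¹ ≤ (2 / t) ^ n := by
    rw [← inv_pow, ← inv_div t 2]
    gcongr
    linarith
  calc (a ^ n)⁻¹ * (b ^ n)⁻¹ ≤ (a ^ n)⁻¹ * (2 / t) ^ n := by gcongr
    _ ≤ ((a ^ n)⁻¹ + (b ^ n)⁻¹) * (2 / t) ^ n := by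
      gcongr
      exact le_add_of_nonneg_right (by positivity)

/-- For `Φ(x) = (1 + |x|)^{-(d+1)}` on `ℝᵈ`, `d ≥ 1`, and any `s ∈ ℝᵈ`,
`∫ Φ(u)·Φ(s − u) du ≤ 2·‖Φ‖₁·(2/(2+|s|))^{d+1}`. -/
theorem convolution_decay_estimate
    (d : ℕ) (hd : 1 ≤ d) (Φ : EuclideanSpace ℝ (Fin d) → ℝ)
    (hΦ : ∀ x, Φ x = ((1 + ‖x‖) ^ (d + 1))⁻¹) (s : EuclideanSpace ℝ (Fin d)) :
    ∫ u, Φ u * Φ (s - u) ≤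
      2 * (∫ u, Φ u) * (2 / (2 + ‖s‖)) ^ (d + 1) := by
  have hint : Integrable Φ := by
    rw [funext hΦ]
    exact integrable_inv_one_add_norm_pow d
  have hint' : Integrable fun u ↦ Φ (s - u) := hint.comp_sub_left s
  calc ∫ u, Φ u * Φ (s - u)
      ≤ ∫ u, (Φ u + Φ (s - u)) * (2 / (2 + ‖s‖)) ^ (d + 1) := by
        refine integral_mono_of_nonneg (Filter.Eventually.of_forall fun u ↦ ?_)
          ((hint.add hint').mul_const _) (Filter.Eventually.of_forall fun u ↦ ?_)
        · simp only [hΦ, Pi.zero_apply]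
          positivity
        · simp only [hΦ]
          have htri : ‖s‖ ≤ ‖u‖ + ‖s - u‖ := by
            simpa using norm_add_le u (s - u)
          exact inv_pow_mul_inv_pow_le (by positivity) (by positivity) (by positivity)
            (by linarith) _
    _ = 2 * (∫ u, Φ u) * (2 / (2 + ‖s‖)) ^ (d + 1) := by
        rw [integral_mul_const, integral_add hint hint', integral_sub_left_eq_self Φ volume s,
          two_mul]
end

section
/- Let S ⊆ ℝᵈ be uniformly discrete, and let f and h be smooth compactly supported complex-valued functions on ℝᵈ. Then there exists a constant C > 0 (depending only on f, h and S) such that for every real t ≥ 1, ∑_{s∈S} |𝓕(z ↦ f(z)·h(t·z))(s)| ≤ C·t, where 𝓕g(ξ) = ∫_{ℝᵈ} g(z)·e^{−2πi z·ξ} dz denotes the Fourier transform. -/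
open MeasureTheory
open scoped FourierTransform SchwartzMap

theorem SchwartzMap.exists_norm_le_one_add_norm_rpow {V F : Type*} [NormedAddCommGroup V]
    [NormedSpace ℝ V] [NormedAddCommGroup F] [NormedSpace ℝ F] (g : 𝓢(V, F)) (n : ℕ) :
    ∃ A : ℝ, 0 ≤ A ∧ ∀ y, ‖g y‖ ≤ A * (1 + ‖y‖) ^ (-(n : ℝ)) := by
  refine ⟨2 ^ n * (Finset.Iic (n, 0)).sup (fun m => SchwartzMap.seminorm ℝ m.1 m.2) g,
    by positivity, fun y => ?_⟩
  have h := SchwartzMap.one_add_le_sup_seminorm_apply (𝕜 := ℝ) (m := (n, 0)) le_rfl le_rfl g y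
  rw [norm_iteratedFDeriv_zero] at h
  rw [Real.rpow_neg (by positivity), Real.rpow_natCast, ← div_eq_mul_inv,
    le_div_iff₀ (by positivity)]
  linarith

section UniformlyDiscrete

variable {V : Type*} [NormedAddCommGroup V] [InnerProductSpace ℝ V] [FiniteDimensional ℝ V]
  [MeasurableSpace V] [BorelSpace V]

/-- Over `δ`-separated finite sets, the translates of an integrable power of `1 + ‖x‖`
have uniformly bounded sums. -/
theorem exists_sum_one_add_norm_add_rpow_le {δ r : ℝ} (hδ : 0 < δ)
    (hr : (Module.finrank ℝ V : ℝ) < r) :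
    ∃ M : ℝ, 0 ≤ M ∧ ∀ T : Finset V, (∀ a ∈ T, ∀ b ∈ T, a ≠ b → δ ≤ ‖a - b‖) →
      ∀ x : V, ∑ s ∈ T, (1 + ‖s + x‖) ^ (-r) ≤ M := by
  have hr0 : 0 ≤ r := (Nat.cast_nonneg _).trans hr.le
  have hint : Integrable (fun y : V => (1 + ‖y‖) ^ (-r)) := integrable_one_add_norm hr
  have hnonneg : ∀ y : V, 0 ≤ (1 + ‖y‖) ^ (-r) := fun y => by positivity
  set v : ℝ := volume.real (Metric.ball (0 : V) (δ / 2)) with hv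
  have hvpos : 0 < v :=
    ENNReal.toReal_pos (Metric.measure_ball_pos _ _ (half_pos hδ)).ne' measure_ball_lt_top.ne
  set c : ℝ := (1 + δ / 2) ^ (-r) with hc
  have hcpos : 0 < c := by positivity
  have hI : 0 ≤ ∫ y : V, (1 + ‖y‖) ^ (-r) := integral_nonneg hnonneg
  refine ⟨(∫ y : V, (1 + ‖y‖) ^ (-r)) / (c * v), by positivity, fun T hT x => ?_⟩
  rw [le_div_iff₀ (by positivity), Finset.sum_mul]
  have hball : ∀ s ∈ T, (1 + ‖s + x‖) ^ (-r) * (c * v) ≤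
      ∫ y in Metric.ball (s + x) (δ / 2), (1 + ‖y‖) ^ (-r) := by
    intro s _
    have hlow : ∀ y ∈ Metric.ball (s + x) (δ / 2),
        c * (1 + ‖s + x‖) ^ (-r) ≤ (1 + ‖y‖) ^ (-r) := by
      intro y hy
      rw [hc, ← Real.mul_rpow (by positivity) (by positivity)]
      refine Real.rpow_le_rpow_of_nonpos (by positivity) ?_ (by linarith)
      have h1 : ‖y‖ ≤ ‖y - (s + x)‖ + ‖s + x‖ := by
        simpa using norm_add_le (y - (s + x)) (s + x)
      rw [mem_ball_iff_norm] at hy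
      nlinarith [norm_nonneg (s + x), mul_nonneg hδ.le (norm_nonneg (s + x))]
    have h2 := setIntegral_ge_of_const_le_real Metric.isOpen_ball.measurableSet
      measure_ball_lt_top.ne hlow hint.integrableOn
    have h3 : volume.real (Metric.ball (s + x) (δ / 2)) = v := by
      simp only [hv, measureReal_def, Measure.addHaar_ball_center]
    rw [h3] at h2
    linarith
  refine (Finset.sum_le_sum hball).trans ?_
  rw [← integral_biUnion_finset T (fun _ _ => Metric.isOpen_ball.measurableSet) _
    (fun _ _ => hint.integrableOn)]
  · exact setIntegral_le_integral hint (Filter.Eventually.of_forall hnonneg)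
  · intro a ha b hb hab
    refine Metric.ball_disjoint_ball ?_
    rw [dist_add_right, dist_eq_norm]
    linarith [hT a ha b hb hab]

/-- The Fourier transform of `z ↦ f z * 𝓕 k (t • z)` as an average of translates of `𝓕 f`. -/
theorem fourier_mul_fourier_comp_smul {f k : V → ℂ} (hf : Integrable f) (hk : Integrable k)
    (t : ℝ) (s : V) :
    𝓕 (fun z => f z * 𝓕 k (t • z)) s = ∫ η, k η * 𝓕 f (s + t • η) := by
  have hg : Integrable (fun z => Real.fourierChar (-inner ℝ z s) • f z) :=
    (Real.fourierIntegral_convergent_iff s).2 hf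
  have key := VectorFourier.integral_fourierIntegral_smul_eq_flip (μ := volume) (ν := volume)
    (L := t • innerₗ V) Real.continuous_fourierChar
    (by simp only [LinearMap.smul_apply, innerₗ_apply_apply]; fun_prop) hk hg
  simp only [VectorFourier.fourierIntegral, LinearMap.smul_apply, LinearMap.flip_apply,
    innerₗ_apply_apply, smul_eq_mul] at key
  simp only [Real.fourier_eq]
  convert key using 1
  · refine integral_congr_ae (Filter.Eventually.of_forall fun z => ?_)
    simp only [inner_smul_right, Circle.smul_def, smul_eq_mul]
    ring
  · refine integral_congr_ae (Filter.Eventually.of_forall fun η => ?_)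
    simp only
    congr 1
    refine integral_congr_ae (Filter.Eventually.of_forall fun z => ?_)
    simp only [smul_smul, ← AddChar.map_add_eq_mul, inner_add_right, inner_smul_right,
      real_inner_comm]
    congr 2
    ring

/-- Sums over a uniformly discrete set of the Fourier transform of `z ↦ f z * h (t • z)` are
bounded independently of `t`. -/
theorem exists_sum_norm_fourier_mul_comp_smul_le {δ : ℝ} (hδ : 0 < δ) (f h : 𝓢(V, ℂ)) :
    ∃ C : ℝ, 0 ≤ C ∧ ∀ T : Finset V, (∀ a ∈ T, ∀ b ∈ T, a ≠ b → δ ≤ ‖a - b‖) →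
      ∀ t : ℝ, ∑ s ∈ T, ‖𝓕 (fun z => f z * h (t • z)) s‖ ≤ C := by
  obtain ⟨A, hA, hfA⟩ := (𝓕 f).exists_norm_le_one_add_norm_rpow (Module.finrank ℝ V + 1)
  obtain ⟨M, hM, hTM⟩ := exists_sum_one_add_norm_add_rpow_le (V := V)
    (r := ((Module.finrank ℝ V + 1 : ℕ) : ℝ)) hδ (by push_cast; linarith)
  set k : 𝓢(V, ℂ) := 𝓕⁻ h with hk
  have hkh : ∀ z, 𝓕 (k : V → ℂ) z = h z := fun z => by
    rw [← SchwartzMap.fourier_coe, hk, FourierTransform.fourier_fourierInv_eq]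
  have hkint : Integrable (k : V → ℂ) := k.integrable
  refine ⟨(∫ η, ‖k η‖) * (A * M), by positivity, fun T hT t => ?_⟩
  have hpt : ∀ s η : V, ‖k η * 𝓕 (f : V → ℂ) (s + t • η)‖ ≤
      ‖k η‖ * (A * (1 + ‖s + t • η‖) ^ (-((Module.finrank ℝ V + 1 : ℕ) : ℝ))) := fun s η => by
    rw [norm_mul]
    exact mul_le_mul_of_nonneg_left (hfA _) (norm_nonneg _)
  have hintegrable : ∀ s : V, Integrable (fun η => ‖k η * 𝓕 (f : V → ℂ) (s + t • η)‖) := by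
    intro s
    have hcont : Continuous (fun η : V => 𝓕 (f : V → ℂ) (s + t • η)) := by
      rw [← SchwartzMap.fourier_coe]
      exact (𝓕 f).continuous.comp (by fun_prop)
    refine (hkint.mul_bdd (c := A) hcont.aestronglyMeasurable
      (Filter.Eventually.of_forall fun η => (hfA _).trans ?_)).norm
    refine mul_le_of_le_one_right hA (Real.rpow_le_one_of_one_le_of_nonpos ?_ ?_)
    · linarith [norm_nonneg (s + t • η)]
    · exact neg_nonpos.2 (Nat.cast_nonneg _)
  calc ∑ s ∈ T, ‖𝓕 (fun z => f z * h (t • z)) s‖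
      ≤ ∑ s ∈ T, ∫ η, ‖k η * 𝓕 (f : V → ℂ) (s + t • η)‖ := by
        refine Finset.sum_le_sum fun s _ => ?_
        simp only [← hkh]
        rw [fourier_mul_fourier_comp_smul f.integrable hkint]
        exact norm_integral_le_integral_norm _
    _ = ∫ η, ∑ s ∈ T, ‖k η * 𝓕 (f : V → ℂ) (s + t • η)‖ :=
        (integral_finsetSum _ fun s _ => hintegrable s).symm
    _ ≤ ∫ η, ‖k η‖ * (A * M) := by
        refine integral_mono (integrable_finsetSum _ fun s _ => hintegrable s)
          (hkint.norm.mul_const _) fun η => ?_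
        refine (Finset.sum_le_sum fun s _ => hpt s η).trans ?_
        rw [← Finset.mul_sum, ← Finset.mul_sum]
        have := hTM T hT (t • η)
        gcongr
    _ = (∫ η, ‖k η‖) * (A * M) := integral_mul_const _ _

end UniformlyDiscrete

/-- For `S ⊆ ℝᵈ` uniformly discrete and `f, h` smooth compactly
supported, there is `C > 0` such that for all `t ≥ 1`,
`∑_{s ∈ S} |𝓕(z ↦ f(z)·h(t·z))(s)| ≤ C·t`. -/
theorem fourier_sum_estimate_uniformly_discrete
    (d : ℕ) (S : Set (EuclideanSpace ℝ (Fin d)))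
    (hS : ∃ δ > (0 : ℝ), ∀ r ∈ S, ∀ s ∈ S, r ≠ s → δ ≤ ‖r - s‖)
    (f h : EuclideanSpace ℝ (Fin d) → ℂ)
    (hf : ContDiff ℝ (⊤ : ℕ∞) f) (hfc : HasCompactSupport f)
    (hh : ContDiff ℝ (⊤ : ℕ∞) h) (hhc : HasCompactSupport h) :
    ∃ C > (0 : ℝ), ∀ t : ℝ, 1 ≤ t →
      Summable (fun s : S =>
        ‖𝓕 (fun z => f z * h (t • z)) (s : EuclideanSpace ℝ (Fin d))‖) ∧
      ∑' s : S, ‖𝓕 (fun z => f z * h (t • z)) (s : EuclideanSpace ℝ (Fin d))‖ ≤ C * t := by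
  obtain ⟨δ, hδ, hsep⟩ := hS
  obtain ⟨C, hC, hbound⟩ := exists_sum_norm_fourier_mul_comp_smul_le hδ
    (hfc.toSchwartzMap hf) (hhc.toSchwartzMap hh)
  refine ⟨C + 1, by positivity, fun t ht => ?_⟩
  have hsum : ∀ T : Finset S, ∑ s ∈ T,
      ‖𝓕 (fun z => f z * h (t • z)) (s : EuclideanSpace ℝ (Fin d))‖ ≤ C := by
    intro T
    have := hbound (T.map (Function.Embedding.subtype _)) (by
      simp only [Finset.mem_map, Function.Embedding.subtype_apply]
      rintro _ ⟨a, -, rfl⟩ _ ⟨b, -, rfl⟩ hab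
      exact hsep a a.2 b b.2 hab) t
    simpa using this
  have hle : C ≤ (C + 1) * t := by nlinarith
  exact ⟨summable_of_sum_le (fun _ => norm_nonneg _) hsum,
    (Real.tsum_le_of_sum_le (fun _ => norm_nonneg _) hsum).trans hle⟩
end

section
/- The set of Schwartz functions φ on ℝᵈ whose Fourier transform 𝓕φ has compact support is dense in the Schwartz space 𝓢(ℝᵈ) (with its usual Fréchet topology given by the Schwartz seminorms). -/
open scoped FourierTransform

open scoped ContDiff SchwartzMap Topology

section CompactSupport

variable {E F : Type*} [NormedAddCommGroup E] [NormedSpace ℝ E]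
  [NormedAddCommGroup F] [NormedSpace ℝ F]

/-- The derivatives of `ψ (ε x) - 1`, for a cutoff `ψ` with `ψ 0 = 1`, are `O(ε (1 + ‖x‖))`. -/
theorem exists_norm_iteratedFDeriv_cutoff_sub_one_le {ψ : E → ℝ}
    (hψ : HasCompactSupport ψ) (hψ' : ContDiff ℝ ∞ ψ) (hψ0 : ψ 0 = 1) (i : ℕ) :
    ∃ C, 0 ≤ C ∧ ∀ ε : ℝ, 0 < ε → ε ≤ 1 → ∀ x : E,
      ‖iteratedFDeriv ℝ i (fun y ↦ ψ (ε • y) - 1) x‖ ≤ C * ε * (1 + ‖x‖) := by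
  rcases Nat.eq_zero_or_pos i with rfl | hi
  · obtain ⟨K, hK⟩ := hψ'.lipschitzWith_of_hasCompactSupport hψ (by simp)
    refine ⟨K, K.2, fun ε hε _ x ↦ ?_⟩
    have h := hK.norm_sub_le (ε • x) 0
    rw [hψ0, sub_zero, norm_smul, Real.norm_of_nonneg hε.le] at h
    rw [norm_iteratedFDeriv_zero]
    refine h.trans ?_
    rw [mul_assoc]
    gcongr
    linarith
  · have hψi : ContDiff ℝ i ψ := hψ'.of_le (mod_cast le_top)
    obtain ⟨C, hC⟩ := (hψ.iteratedFDeriv (𝕜 := ℝ) i).exists_bound_of_continuous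
      hψi.continuous_iteratedFDeriv'
    have hC0 : 0 ≤ C := (norm_nonneg _).trans (hC 0)
    refine ⟨C, hC0, fun ε hε hε1 x ↦ ?_⟩
    have hcomp : ContDiff ℝ i (fun y ↦ ψ (ε • y)) := hψi.comp (contDiff_const_smul ε)
    rw [fun_iteratedFDeriv_sub_apply hcomp.contDiffAt contDiffAt_const,
      iteratedFDeriv_const_of_ne hi.ne', Pi.zero_apply, sub_zero,
      iteratedFDeriv_comp_const_smul ε hψi, norm_smul, norm_pow, Real.norm_of_nonneg hε.le]
    calc ε ^ i * ‖iteratedFDeriv ℝ i ψ (ε • x)‖ ≤ ε * C := by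
          gcongr
          · exact pow_le_of_le_one hε.le hε1 hi.ne'
          · exact hC _
      _ ≤ C * ε * (1 + ‖x‖) := by
          rw [mul_comm ε C]
          exact le_mul_of_one_le_right (by positivity) (by linarith [norm_nonneg x])

namespace SchwartzMap

theorem exists_seminorm_cutoff_sub_le {ψ : E → ℝ} (hψ : HasCompactSupport ψ)
    (hψ' : ContDiff ℝ ∞ ψ) (hψ0 : ψ 0 = 1) (f : 𝓢(E, F)) (k m : ℕ) :
    ∃ C, ∀ ε : ℝ, 0 < ε → ε ≤ 1 → ∀ g : 𝓢(E, F), (∀ x, g x = ψ (ε • x) • f x) →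
      SchwartzMap.seminorm ℝ k m (g - f) ≤ C * ε := by
  choose B hB0 hB using exists_norm_iteratedFDeriv_cutoff_sub_one_le hψ hψ' hψ0
  set D : ℕ → ℝ := fun i ↦ SchwartzMap.seminorm ℝ k i f + SchwartzMap.seminorm ℝ (k + 1) i f
  have hD (i : ℕ) : 0 ≤ D i := by positivity
  refine ⟨∑ i ∈ Finset.range (m + 1), m.choose i * B i * D (m - i), fun ε hε hε1 g hg ↦ ?_⟩
  have hsum : 0 ≤ ∑ i ∈ Finset.range (m + 1), m.choose i * B i * D (m - i) :=
    Finset.sum_nonneg fun i _ ↦ mul_nonneg (mul_nonneg (by positivity) (hB0 i)) (hD _)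
  refine SchwartzMap.seminorm_le_bound ℝ k m _ (by positivity) fun x ↦ ?_
  have hgf : ⇑(g - f) = fun y ↦ (ψ (ε • y) - 1) • f y := by
    ext y
    rw [sub_apply, hg, sub_smul, one_smul]
  have hsmooth : ContDiff ℝ ∞ fun y ↦ ψ (ε • y) - 1 :=
    (hψ'.comp (contDiff_const_smul ε)).sub contDiff_const
  have hle := norm_iteratedFDeriv_smul_le hsmooth (f.smooth ⊤) x (n := m) (mod_cast le_top)
  rw [hgf]
  refine (mul_le_mul_of_nonneg_left hle (by positivity)).trans ?_
  rw [Finset.mul_sum, Finset.sum_mul]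
  refine Finset.sum_le_sum fun i _ ↦ ?_
  have hf : ‖x‖ ^ k * (1 + ‖x‖) * ‖iteratedFDeriv ℝ (m - i) f x‖ ≤ D (m - i) := by
    have h₁ := SchwartzMap.le_seminorm ℝ k (m - i) f x
    have h₂ := SchwartzMap.le_seminorm ℝ (k + 1) (m - i) f x
    calc _ = ‖x‖ ^ k * ‖iteratedFDeriv ℝ (m - i) f x‖
          + ‖x‖ ^ (k + 1) * ‖iteratedFDeriv ℝ (m - i) f x‖ := by ring
      _ ≤ _ := add_le_add h₁ h₂
  calc _ ≤ ‖x‖ ^ k * (m.choose i * (B i * ε * (1 + ‖x‖)) *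
        ‖iteratedFDeriv ℝ (m - i) f x‖) := by
        gcongr
        exact hB i ε hε hε1 x
    _ = m.choose i * B i * ε * (‖x‖ ^ k * (1 + ‖x‖) * ‖iteratedFDeriv ℝ (m - i) f x‖) := by ring
    _ ≤ m.choose i * B i * ε * D (m - i) :=
        mul_le_mul_of_nonneg_left hf (mul_nonneg (mul_nonneg (by positivity) (hB0 i)) hε.le)
    _ = _ := by ring

/-- Compactly supported smooth functions are dense in the Schwartz space. -/
theorem dense_hasCompactSupport [FiniteDimensional ℝ E] :
    Dense {f : 𝓢(E, F) | HasCompactSupport f} := by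
  intro f
  obtain ⟨ψ, -, hψ, hψ', -, hψ0⟩ :=
    exists_contDiff_tsupport_subset (n := ⊤) (Filter.univ_mem : Set.univ ∈ 𝓝 (0 : E))
  have hscale (n : ℕ) : HasCompactSupport fun x ↦ ψ ((1 / ((n : ℝ) + 1)) • x) • f x :=
    (hψ.comp_smul (by positivity)).smul_right
  have hsmooth (n : ℕ) : ContDiff ℝ ∞ fun x ↦ ψ ((1 / ((n : ℝ) + 1)) • x) • f x :=
    (hψ'.comp (contDiff_const_smul _)).smul (f.smooth ⊤)
  refine mem_closure_of_tendsto (b := Filter.atTop)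
    (f := fun n ↦ (hscale n).toSchwartzMap (hsmooth n)) ?_ (.of_forall hscale)
  rw [(schwartz_withSeminorms ℝ E F).tendsto_nhds]
  rintro ⟨k, m⟩ δ hδ
  obtain ⟨C, hC⟩ := exists_seminorm_cutoff_sub_le hψ hψ' hψ0 f k m
  have hlim : Filter.Tendsto (fun n : ℕ ↦ C * (1 / ((n : ℝ) + 1))) Filter.atTop (𝓝 0) := by
    simpa using tendsto_one_div_add_atTop_nhds_zero_nat.const_mul C
  filter_upwards [hlim.eventually_lt_const hδ] with n hn
  refine (hC _ (by positivity) ?_ _ fun x ↦ rfl).trans_lt hn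
  rw [div_le_one (by positivity)]
  linarith [(Nat.cast_nonneg n : (0 : ℝ) ≤ n)]

end SchwartzMap

end CompactSupport

/-- Schwartz functions whose Fourier transform has compact support are
dense in the Schwartz space `𝓢(ℝᵈ)`. -/
theorem dense_schwartz_with_compactly_supported_fourier_transform (d : ℕ) :
    Dense {φ : SchwartzMap (EuclideanSpace ℝ (Fin d)) ℂ |
      HasCompactSupport (𝓕 ⇑φ)} := by
  have hsurj : Function.Surjective
      (𝓕⁻ : 𝓢(EuclideanSpace ℝ (Fin d), ℂ) → 𝓢(EuclideanSpace ℝ (Fin d), ℂ)) :=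
    fun φ ↦ ⟨𝓕 φ, FourierTransform.fourierInv_fourier_eq φ⟩
  refine (hsurj.denseRange.dense_image
    FourierTransform.continuous_fourierInv
    SchwartzMap.dense_hasCompactSupport).mono ?_
  rintro _ ⟨f, hf, rfl⟩
  rw [Set.mem_ofPred_eq, ← SchwartzMap.fourier_coe, FourierTransform.fourier_fourierInv_eq]
  exact hf
end
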